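/- arXiv:2408.02613 — 2 statements merged into one kernel-verified Lean document; each statement's English description precedes it below -/
import Mathlib

section
/- Let ω > 0. For every η = (η₁, η₂) ∈ ℝ², one has J_ω^[2](η) = Σ_{m=0}^∞ ((−1)^m / (m! · Γ(m + ω + 1))) · (|η|/2)^(2m + ω), where |η| = (η₁² + η₂²)^(1/2) is the Euclidean norm. In particular, J_ω^[2] is spherically symmetric and coincides with the classical Bessel function of the first kind of order ω evaluated at |η|. -/
open Real MeasureTheory

/-- The `p`-norm of a point of `ℝ²`. -/
noncomputable def pnorm (p : ℝ) (x : ℝ × ℝ) : ℝ := (|x.1| ^ p + |x.2| ^ p) ^ (1 / p)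

/-- The generalized Bessel function of order zero `J₀^[p]`. -/
noncomputable def Jzero (p : ℝ) (η : ℝ × ℝ) : ℝ :=
  (1 / Real.Gamma (1 / p) ^ 2) * (2 / p) ^ 2 *
    ∫ t in (0:ℝ)..1,
      Real.cos (η.1 * t ^ (1 / p)) * Real.cos (η.2 * (1 - t) ^ (1 / p)) *
        t ^ (1 / p - 1) * (1 - t) ^ (1 / p - 1)

/-- The generalized Bessel function of positive order `J_ω^[p]`. -/
noncomputable def Jord (p ω : ℝ) (η : ℝ × ℝ) : ℝ :=
  pnorm p η ^ ω / (p ^ (ω - 1) * Real.Gamma ω) *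
    ∫ τ in (0:ℝ)..1, Jzero p (τ * η.1, τ * η.2) * τ * (1 - τ ^ p) ^ (ω - 1)

/-- `e^{2πiθ}`. -/
noncomputable def e2πi (θ : ℝ) : ℂ := Complex.exp (((2 * Real.pi * θ : ℝ) : ℂ) * Complex.I)

/-- The integral version `𝒟_β^[p](s : x)`. -/
noncomputable def Dcal (p β s : ℝ) (x : ℝ × ℝ) : ℂ :=
  ((1 / Real.Gamma (β + 1) : ℝ) : ℂ) *
    ∫ ξ in {ξ : ℝ × ℝ | pnorm p ξ ^ p < s},
      (((s - pnorm p ξ ^ p) ^ β : ℝ) : ℂ) * e2πi (x.1 * ξ.1 + x.2 * ξ.2)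

/-- The lattice sum version `D_β^[p](s : x)`. -/
noncomputable def Dlat (p β s : ℝ) (x : ℝ × ℝ) : ℂ :=
  ((1 / Real.Gamma (β + 1) : ℝ) : ℂ) *
    ∑' m : ℤ × ℤ,
      if pnorm p ((m.1 : ℝ), (m.2 : ℝ)) ^ p < s then
        (((s - pnorm p ((m.1 : ℝ), (m.2 : ℝ)) ^ p) ^ β : ℝ) : ℂ) *
          e2πi (x.1 * (m.1 : ℝ) + x.2 * (m.2 : ℝ))
      else 0

open Set in
/-- Termwise integration against an integrable weight on the unit interval. -/
theorem hasSum_integral_Ioo_mul_of_abs_le {ι : Type*} [Countable ι] {c : ι → ℝ} {F : ι → ℝ → ℝ}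
    {f w : ℝ → ℝ} (hc : Summable c) (hw : IntegrableOn w (Ioo 0 1))
    (hF : ∀ i, Measurable (F i)) (hFc : ∀ i, ∀ t ∈ Ioo (0 : ℝ) 1, |F i t| ≤ c i)
    (hf : ∀ t ∈ Ioo (0 : ℝ) 1, HasSum (fun i => F i t) (f t)) :
    HasSum (fun i => ∫ t in Ioo (0 : ℝ) 1, F i t * w t) (∫ t in Ioo (0 : ℝ) 1, f t * w t) := by
  refine hasSum_integral_of_dominated_convergence (fun i t => c i * |w t|) (fun i => ?_)
    (fun i => ?_) ?_ ?_ ?_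
  · exact (hF i).aestronglyMeasurable.mul hw.aestronglyMeasurable
  · filter_upwards [ae_restrict_mem measurableSet_Ioo] with t ht
    rw [norm_mul, Real.norm_eq_abs, Real.norm_eq_abs]
    exact mul_le_mul_of_nonneg_right (hFc i t ht) (abs_nonneg _)
  · exact Filter.Eventually.of_forall fun t => hc.mul_right _
  · simp_rw [tsum_mul_right]
    exact hw.abs.const_mul _
  · filter_upwards [ae_restrict_mem measurableSet_Ioo] with t ht
    exact (hf t ht).mul_right _

theorem cpow_mul_one_sub_cpow_ofReal {t : ℝ} (ht : t ∈ Set.Ioo (0 : ℝ) 1) (a b : ℝ) :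
    (t : ℂ) ^ ((a : ℂ) - 1) * (1 - t : ℂ) ^ ((b : ℂ) - 1) =
      ((t ^ (a - 1) * (1 - t) ^ (b - 1) : ℝ) : ℂ) := by
  rw [Complex.ofReal_mul, Complex.ofReal_cpow ht.1.le, Complex.ofReal_cpow (sub_pos.2 ht.2).le]
  push_cast
  rfl

open Set in
theorem integrableOn_rpow_mul_one_sub_rpow {a b : ℝ} (ha : 0 < a) (hb : 0 < b) :
    IntegrableOn (fun t : ℝ => t ^ (a - 1) * (1 - t) ^ (b - 1)) (Ioo 0 1) := by
  have h := Complex.betaIntegral_convergent (u := a) (v := b) (by simpa) (by simpa)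
  rw [intervalIntegrable_iff_integrableOn_Ioo_of_le zero_le_one] at h
  refine IntegrableOn.congr_fun h.re (fun t ht => ?_) measurableSet_Ioo
  simp only [cpow_mul_one_sub_cpow_ofReal ht, RCLike.re_to_complex, Complex.ofReal_re]

open Set in
theorem integral_Ioo_rpow_mul_one_sub_rpow {a b : ℝ} (ha : 0 < a) (hb : 0 < b) :
    ∫ t in Ioo (0 : ℝ) 1, t ^ (a - 1) * (1 - t) ^ (b - 1) =
      Real.Gamma a * Real.Gamma b / Real.Gamma (a + b) := by
  have h := Complex.betaIntegral_eq_Gamma_mul_div a b (by simpa) (by simpa)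
  rw [Complex.betaIntegral, intervalIntegral.integral_of_le zero_le_one,
    integral_Ioc_eq_integral_Ioo, setIntegral_congr_fun (g := fun t : ℝ =>
      ((t ^ (a - 1) * (1 - t) ^ (b - 1) : ℝ) : ℂ)) measurableSet_Ioo, integral_complex_ofReal,
    ← Complex.ofReal_add, Complex.Gamma_ofReal, Complex.Gamma_ofReal, Complex.Gamma_ofReal] at h
  · exact_mod_cast h
  · exact fun t ht => cpow_mul_one_sub_cpow_ofReal ht a b

open Set in
theorem integral_Ioo_pow_mul_rpow_mul_one_sub_rpow {a b : ℝ} (ha : 0 < a) (hb : 0 < b)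
    (j k : ℕ) :
    ∫ t in Ioo (0 : ℝ) 1, t ^ j * (1 - t) ^ k * (t ^ (a - 1) * (1 - t) ^ (b - 1)) =
      Real.Gamma (a + j) * Real.Gamma (b + k) / Real.Gamma (a + j + (b + k)) := by
  rw [← integral_Ioo_rpow_mul_one_sub_rpow (by positivity) (by positivity)]
  refine setIntegral_congr_fun measurableSet_Ioo fun t ht => ?_
  have h1 : (0 : ℝ) < 1 - t := by linarith [ht.2]
  simp only [add_sub_right_comm, Real.rpow_add_natCast ht.1.ne', Real.rpow_add_natCast h1.ne']
  ring

theorem image_sq_Ioo_zero_one : (fun τ : ℝ => τ ^ 2) '' Set.Ioo 0 1 = Set.Ioo 0 1 := by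
  ext u
  constructor
  · rintro ⟨τ, ⟨h0, h1⟩, rfl⟩
    exact ⟨by positivity, by nlinarith⟩
  · rintro ⟨h0, h1⟩
    exact ⟨√u, ⟨Real.sqrt_pos.2 h0, (Real.sqrt_lt' one_pos).2 (by simpa)⟩, Real.sq_sqrt h0.le⟩

theorem injOn_sq_Ioo_zero_one : Set.InjOn (fun τ : ℝ => τ ^ 2) (Set.Ioo 0 1) :=
  fun _ hx _ hy h => (pow_left_inj₀ hx.1.le hy.1.le two_ne_zero).1 h

open Set in
theorem integral_Ioo_comp_sq_mul (g : ℝ → ℝ) :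
    ∫ τ in Ioo (0 : ℝ) 1, τ * g (τ ^ 2) = (∫ t in Ioo (0 : ℝ) 1, g t) / 2 := by
  have h := integral_image_eq_integral_abs_deriv_smul (s := Ioo (0 : ℝ) 1) measurableSet_Ioo
    (fun τ _ => (hasDerivAt_pow 2 τ).hasDerivWithinAt) injOn_sq_Ioo_zero_one g
  rw [image_sq_Ioo_zero_one] at h
  rw [h, ← integral_div]
  refine setIntegral_congr_fun measurableSet_Ioo fun τ hτ => ?_
  have := hτ.1
  simp [abs_of_pos this]
  ring

open Set in
theorem integrableOn_mul_one_sub_sq_rpow {ω : ℝ} (hω : 0 < ω) :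
    IntegrableOn (fun τ : ℝ => τ * (1 - τ ^ 2) ^ (ω - 1)) (Ioo 0 1) := by
  have h := (integrableOn_image_iff_integrableOn_abs_deriv_smul (s := Ioo (0 : ℝ) 1)
    measurableSet_Ioo (fun τ _ => (hasDerivAt_pow 2 τ).hasDerivWithinAt) injOn_sq_Ioo_zero_one
    (fun t : ℝ => t ^ ((1 : ℝ) - 1) * (1 - t) ^ (ω - 1))).1 (by
      rw [image_sq_Ioo_zero_one]
      exact integrableOn_rpow_mul_one_sub_rpow one_pos hω)
  refine IntegrableOn.congr_fun (h.div_const 2) (fun τ hτ => ?_) measurableSet_Ioo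
  have := hτ.1
  simp [abs_of_pos this]
  ring

open Set in
theorem integral_Ioo_pow_mul_one_sub_sq_rpow {ω : ℝ} (hω : 0 < ω) (m : ℕ) :
    ∫ τ in Ioo (0 : ℝ) 1, (τ ^ 2) ^ m * (τ * (1 - τ ^ 2) ^ (ω - 1)) =
      (m.factorial : ℝ) * Real.Gamma ω / Real.Gamma (m + ω + 1) / 2 := by
  have h := integral_Ioo_pow_mul_rpow_mul_one_sub_rpow one_pos hω m 0
  have h2 := integral_Ioo_comp_sq_mul fun t => t ^ m * (1 - t) ^ (ω - 1)
  simp only [sub_self, Real.rpow_zero, one_mul, pow_zero, mul_one, Nat.cast_zero, add_zero] at h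
  rw [h, add_comm (1 : ℝ) m, Real.Gamma_nat_eq_factorial] at h2
  rw [show (m : ℝ) + ω + 1 = m + 1 + ω by ring, ← h2]
  exact integral_congr_ae (Filter.Eventually.of_forall fun τ => by ring)

theorem Gamma_half_add_nat (j : ℕ) :
    Real.Gamma (1 / 2 + j) = (2 * j).factorial / (4 ^ j * j.factorial) * √π := by
  have h := Real.Gamma_mul_Gamma_add_half ((j : ℝ) + 1 / 2)
  rw [show (j : ℝ) + 1 / 2 + 1 / 2 = j + 1 by ring, Real.Gamma_nat_eq_factorial,
    show 2 * ((j : ℝ) + 1 / 2) = ((2 * j : ℕ) : ℝ) + 1 by push_cast; ring,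
    Real.Gamma_nat_eq_factorial, show 1 - (((2 * j : ℕ) : ℝ) + 1) = -((2 * j : ℕ) : ℝ) by ring,
    Real.rpow_neg two_pos.le, Real.rpow_natCast, pow_mul] at h
  have hj : (j.factorial : ℝ) ≠ 0 := by positivity
  rw [add_comm, div_mul_eq_mul_div, eq_div_iff (by positivity), mul_left_comm, h]
  norm_num
  field_simp

theorem sum_antidiagonal_pow_div_factorial (x y : ℝ) (m : ℕ) :
    ∑ i ∈ Finset.HasAntidiagonal.antidiagonal m, x ^ i.1 / i.1.factorial * (y ^ i.2 / i.2.factorial) =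
      (x + y) ^ m / m.factorial := by
  rw [(Commute.all x y).add_pow', Finset.sum_div]
  refine Finset.sum_congr rfl fun i hi => ?_
  rw [Finset.HasAntidiagonal.mem_antidiagonal] at hi
  subst hi
  rw [nsmul_eq_mul, Nat.choose_symm_add, Nat.add_choose]
  rw [Nat.cast_div (Nat.factorial_mul_factorial_dvd_factorial_add _ _) (by positivity)]
  push_cast
  field_simp

theorem Jzero_two_eq_integral_Ioo (η : ℝ × ℝ) :
    Jzero 2 η = 1 / π * ∫ t in Set.Ioo (0 : ℝ) 1,
      Real.cos (η.1 * √t) * Real.cos (η.2 * √(1 - t)) *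
        (t ^ (1 / 2 - 1 : ℝ) * (1 - t) ^ (1 / 2 - 1 : ℝ)) := by
  rw [Jzero, Real.Gamma_one_half_eq, Real.sq_sqrt Real.pi_pos.le, div_self two_ne_zero, one_pow,
    mul_one, intervalIntegral.integral_of_le zero_le_one, integral_Ioc_eq_integral_Ioo]
  simp only [Real.sqrt_eq_rpow, mul_assoc]

theorem hasSum_mul_prod {ι κ : Type*} {f : ι → ℝ} {g : κ → ℝ} {a b : ℝ} (hf : HasSum f a)
    (hg : HasSum g b) : HasSum (fun i : ι × κ => f i.1 * g i.2) (a * b) :=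
  hf.mul hg (summable_mul_of_summable_norm hf.summable.norm hg.summable.norm)

theorem hasSum_cos_mul_sqrt (x : ℝ) {s : ℝ} (hs : 0 ≤ s) :
    HasSum (fun n : ℕ => (-1) ^ n * (x ^ 2 * s) ^ n / ((2 * n).factorial : ℝ))
      (Real.cos (x * √s)) := by
  simpa only [pow_mul, mul_pow, Real.sq_sqrt hs] using Real.hasSum_cos (x * √s)

theorem abs_neg_one_pow_mul_div_le (x : ℝ) {s : ℝ} (hs : 0 ≤ s) (hs1 : s ≤ 1) (n : ℕ) :
    |(-1) ^ n * (x ^ 2 * s) ^ n / ((2 * n).factorial : ℝ)| ≤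
      x ^ (2 * n) / ((2 * n).factorial : ℝ) := by
  rw [abs_div, abs_mul, abs_neg_one_pow, one_mul, Nat.abs_cast, pow_mul,
    abs_of_nonneg (by positivity)]
  gcongr
  exact mul_le_of_le_one_right (sq_nonneg x) hs1

open Set in
theorem integral_Ioo_cos_term_mul_cos_term (x y : ℝ) (j k : ℕ) :
    1 / π * ∫ t in Ioo (0 : ℝ) 1, (-1) ^ j * (x ^ 2 * t) ^ j / ((2 * j).factorial : ℝ) *
        ((-1) ^ k * (y ^ 2 * (1 - t)) ^ k / ((2 * k).factorial : ℝ)) *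
        (t ^ (1 / 2 - 1 : ℝ) * (1 - t) ^ (1 / 2 - 1 : ℝ)) =
      (-1 / 4) ^ (j + k) / ((j + k).factorial : ℝ) *
        ((x ^ 2) ^ j / j.factorial * ((y ^ 2) ^ k / k.factorial)) := by
  have e : ∀ t : ℝ, (-1) ^ j * (x ^ 2 * t) ^ j / ((2 * j).factorial : ℝ) *
      ((-1) ^ k * (y ^ 2 * (1 - t)) ^ k / ((2 * k).factorial : ℝ)) *
      (t ^ (1 / 2 - 1 : ℝ) * (1 - t) ^ (1 / 2 - 1 : ℝ)) =
      ((-1) ^ (j + k) * (x ^ 2) ^ j * (y ^ 2) ^ k /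
        ((2 * j).factorial * (2 * k).factorial)) *
      (t ^ j * (1 - t) ^ k * (t ^ (1 / 2 - 1 : ℝ) * (1 - t) ^ (1 / 2 - 1 : ℝ))) := by
    intro t
    rw [mul_pow, mul_pow, pow_add]
    ring
  simp only [e]
  rw [integral_const_mul, integral_Ioo_pow_mul_rpow_mul_one_sub_rpow one_half_pos one_half_pos,
    Gamma_half_add_nat, Gamma_half_add_nat,
    show (1 / 2 + (j : ℝ) + (1 / 2 + (k : ℝ))) = ((j + k : ℕ) : ℝ) + 1 by
      push_cast; ring, Real.Gamma_nat_eq_factorial]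
  have hπ : √π ^ 2 = π := Real.sq_sqrt Real.pi_pos.le
  have hπ0 : π ≠ 0 := Real.pi_ne_zero
  rw [div_pow, pow_add 4]
  field_simp
  rw [hπ]
  ring

open Set in
theorem hasSum_prod_Jzero_two (η : ℝ × ℝ) :
    HasSum (fun i : ℕ × ℕ => (-1 / 4) ^ (i.1 + i.2) / ((i.1 + i.2).factorial : ℝ) *
      ((η.1 ^ 2) ^ i.1 / i.1.factorial * ((η.2 ^ 2) ^ i.2 / i.2.factorial))) (Jzero 2 η) := by
  have key := hasSum_integral_Ioo_mul_of_abs_le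
    (c := fun i : ℕ × ℕ => η.1 ^ (2 * i.1) / ((2 * i.1).factorial : ℝ) *
      (η.2 ^ (2 * i.2) / ((2 * i.2).factorial : ℝ)))
    (F := fun i t => (-1) ^ i.1 * (η.1 ^ 2 * t) ^ i.1 / ((2 * i.1).factorial : ℝ) *
      ((-1) ^ i.2 * (η.2 ^ 2 * (1 - t)) ^ i.2 / ((2 * i.2).factorial : ℝ)))
    (f := fun t => Real.cos (η.1 * √t) * Real.cos (η.2 * √(1 - t)))
    (hasSum_mul_prod (Real.hasSum_cosh η.1) (Real.hasSum_cosh η.2)).summable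
    (integrableOn_rpow_mul_one_sub_rpow one_half_pos one_half_pos)
    (fun i => by fun_prop) (fun i t ht => ?_) (fun t ht => ?_)
  · rw [Jzero_two_eq_integral_Ioo]
    simpa only [integral_Ioo_cos_term_mul_cos_term] using key.mul_left (1 / π)
  · have h1 : 0 ≤ 1 - t := by linarith [ht.2]
    rw [abs_mul]
    exact mul_le_mul (abs_neg_one_pow_mul_div_le _ ht.1.le ht.2.le _)
      (abs_neg_one_pow_mul_div_le _ h1 (by linarith [ht.1]) _) (abs_nonneg _)
      (by rw [pow_mul]; positivity)
  · have h1 : 0 ≤ 1 - t := by linarith [ht.2]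
    exact hasSum_mul_prod (hasSum_cos_mul_sqrt η.1 ht.1.le) (hasSum_cos_mul_sqrt η.2 h1)

theorem hasSum_Jzero_two (η : ℝ × ℝ) :
    HasSum (fun m : ℕ => (-1 / 4) ^ m * (η.1 ^ 2 + η.2 ^ 2) ^ m / (m.factorial : ℝ) ^ 2)
      (Jzero 2 η) := by
  have h := (Finset.HasAntidiagonal.sigmaAntidiagonalEquivProd.hasSum_iff.2
    (hasSum_prod_Jzero_two η)).sigma fun m => hasSum_fintype _
  convert h using 2 with m
  rw [Finset.univ_eq_attach]
  have e := sum_antidiagonal_pow_div_factorial (η.1 ^ 2) (η.2 ^ 2) m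
  rw [← Finset.sum_attach] at e
  have e2 : ∀ i ∈ (Finset.HasAntidiagonal.antidiagonal m).attach,
      (-1 / 4 : ℝ) ^ (i.1.1 + i.1.2) / ((i.1.1 + i.1.2).factorial : ℝ) *
      ((η.1 ^ 2) ^ i.1.1 / i.1.1.factorial * ((η.2 ^ 2) ^ i.1.2 / i.1.2.factorial)) =
      (-1 / 4 : ℝ) ^ m / (m.factorial : ℝ) *
      ((η.1 ^ 2) ^ i.1.1 / i.1.1.factorial * ((η.2 ^ 2) ^ i.1.2 / i.1.2.factorial)) := by
    intro i _
    rw [Finset.HasAntidiagonal.mem_antidiagonal.1 i.2]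
  refine Eq.trans ?_ (Finset.sum_congr rfl e2).symm
  rw [← Finset.mul_sum, e]
  field_simp

theorem pnorm_two (η : ℝ × ℝ) : pnorm 2 η = √(η.1 ^ 2 + η.2 ^ 2) := by
  simp [pnorm, Real.sqrt_eq_rpow]

open Set in
theorem hasSum_integral_Jzero_two {ω : ℝ} (hω : 0 < ω) (η : ℝ × ℝ) :
    HasSum (fun m : ℕ => (-1 / 4) ^ m * (η.1 ^ 2 + η.2 ^ 2) ^ m * Real.Gamma ω /
        (2 * (m.factorial * Real.Gamma (m + ω + 1))))
      (∫ τ in (0:ℝ)..1, Jzero 2 (τ * η.1, τ * η.2) * τ * (1 - τ ^ (2 : ℝ)) ^ (ω - 1)) := by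
  set s := η.1 ^ 2 + η.2 ^ 2 with hs
  have hs0 : 0 ≤ s := by positivity
  have key := hasSum_integral_Ioo_mul_of_abs_le
    (c := fun m : ℕ => s ^ m / (m.factorial : ℝ))
    (F := fun m τ => (-1 / 4) ^ m * s ^ m / (m.factorial : ℝ) ^ 2 * (τ ^ 2) ^ m)
    (f := fun τ => Jzero 2 (τ * η.1, τ * η.2))
    (Real.summable_pow_div_factorial s) (integrableOn_mul_one_sub_sq_rpow hω)
    (fun i => by fun_prop) ?_ ?_
  · rw [intervalIntegral.integral_of_le zero_le_one, integral_Ioc_eq_integral_Ioo]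
    simp only [Real.rpow_two, mul_assoc] at key ⊢
    convert key using 2 with m
    simp only [← mul_assoc ((-1 / 4 : ℝ) ^ m)]
    rw [integral_const_mul, integral_Ioo_pow_mul_one_sub_sq_rpow hω]
    have : 0 < Real.Gamma (m + ω + 1) := Real.Gamma_pos_of_pos (by positivity)
    field_simp
  · intro m τ hτ
    have h1 : (1 : ℝ) ≤ m.factorial := by exact_mod_cast m.factorial_pos
    have h2 : (τ ^ 2) ^ m ≤ 1 := pow_le_one₀ (sq_nonneg τ) (pow_le_one₀ hτ.1.le hτ.2.le)
    have h3 : |(-1 / 4 : ℝ)| ^ m ≤ 1 := pow_le_one₀ (abs_nonneg _) (by norm_num [abs_le])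
    rw [abs_mul, abs_div, abs_mul, abs_pow, abs_of_nonneg (pow_nonneg hs0 m),
      abs_of_nonneg (by positivity : 0 ≤ (m.factorial : ℝ) ^ 2),
      abs_of_nonneg (by positivity : 0 ≤ (τ ^ 2) ^ m)]
    calc _ ≤ |(-1 / 4 : ℝ)| ^ m * s ^ m / (m.factorial : ℝ) ^ 2 :=
          mul_le_of_le_one_right (by positivity) h2
      _ ≤ s ^ m / m.factorial := by
          gcongr
          · exact mul_le_of_le_one_left (by positivity) h3
          · nlinarith
  · intro τ hτ
    convert hasSum_Jzero_two (τ * η.1, τ * η.2) using 2 with m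
    rw [show (τ * η.1) ^ 2 + (τ * η.2) ^ 2 = s * τ ^ 2 by rw [hs]; ring, mul_pow]
    ring

theorem Jord_two_eq_tsum {ω : ℝ} (hω : 0 < ω) (η : ℝ × ℝ) :
    Jord 2 ω η =
      ∑' m : ℕ, (-1 : ℝ) ^ m / ((Nat.factorial m : ℝ) * Real.Gamma ((m : ℝ) + ω + 1)) *
        (Real.sqrt (η.1 ^ 2 + η.2 ^ 2) / 2) ^ (2 * (m : ℝ) + ω) := by
  rw [Jord, ← (hasSum_integral_Jzero_two hω η).tsum_eq, ← tsum_mul_left, pnorm_two]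
  refine tsum_congr fun m => ?_
  have hs0 : 0 ≤ η.1 ^ 2 + η.2 ^ 2 := by positivity
  have hG : 0 < Real.Gamma (m + ω + 1) := Real.Gamma_pos_of_pos (by positivity)
  have hG' : 0 < Real.Gamma ω := Real.Gamma_pos_of_pos hω
  have h2 : (0 : ℝ) < 2 ^ ω := by positivity
  rw [Real.rpow_add_of_nonneg (by positivity) (by positivity) hω.le,
    show (2 * (m : ℝ)) = ((2 * m : ℕ) : ℝ) by push_cast; ring, Real.rpow_natCast, pow_mul,
    div_pow √_, Real.sq_sqrt hs0, Real.div_rpow (Real.sqrt_nonneg _) two_pos.le,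
    Real.rpow_sub two_pos, Real.rpow_one, div_pow, div_pow _ _ m]
  norm_num
  field_simp

/-- For `p = 2`, the generalized Bessel function `J_ω^[2]` is given by the classical power
series of the Bessel function of the first kind of order `ω` evaluated at the Euclidean
norm `|η|`; in particular it is spherically symmetric. -/
theorem Jord_two_eq_bessel (ω : ℝ) (hω : 0 < ω) (η : ℝ × ℝ) :
    (Jord 2 ω η =
      ∑' m : ℕ, (-1 : ℝ) ^ m / ((Nat.factorial m : ℝ) * Real.Gamma ((m : ℝ) + ω + 1)) *
        (Real.sqrt (η.1 ^ 2 + η.2 ^ 2) / 2) ^ (2 * (m : ℝ) + ω)) ∧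
      ∀ η' : ℝ × ℝ, Real.sqrt (η'.1 ^ 2 + η'.2 ^ 2) = Real.sqrt (η.1 ^ 2 + η.2 ^ 2) →
        Jord 2 ω η' = Jord 2 ω η := by
  refine ⟨Jord_two_eq_tsum hω η, fun η' h => ?_⟩
  rw [Jord_two_eq_tsum hω, Jord_two_eq_tsum hω, h]
end

section
/- Let β > 1/2. Then the function x ↦ 𝒟_β^[2](1 : x) is integrable on ℝ², i.e. the integrability assumption of the main theorem holds for p = 2 whenever β > 1/2. -/
open Real MeasureTheory

lemma hasDerivAt_integral_mul_comp_mul {φ f f' : ℝ → ℝ} (hφ : Continuous φ)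
    (hf : ∀ x, HasDerivAt f (f' x) x) (hf' : Continuous f') (hb : ∀ x, |f' x| ≤ 1) (ω : ℝ) :
    HasDerivAt (fun ω => ∫ t in (-1:ℝ)..1, φ t * f (ω * t))
      (∫ t in (-1:ℝ)..1, φ t * t * f' (ω * t)) ω := by
  have hfc : Continuous f := continuous_iff_continuousAt.2 fun x => (hf x).continuousAt
  refine (intervalIntegral.hasDerivAt_integral_of_dominated_loc_of_deriv_le
    (F := fun ω t => φ t * f (ω * t)) (F' := fun ω t => φ t * t * f' (ω * t))
    (bound := fun t => |φ t * t|) Filter.univ_mem ?_ ?_ ?_ ?_ ?_ ?_).2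
  · exact Filter.Eventually.of_forall fun x =>
      (Continuous.aestronglyMeasurable (by fun_prop))
  · exact Continuous.intervalIntegrable (by fun_prop) _ _
  · exact Continuous.aestronglyMeasurable (by fun_prop)
  · refine Filter.Eventually.of_forall fun t _ x _ => ?_
    rw [Real.norm_eq_abs, abs_mul]
    exact mul_le_of_le_one_right (abs_nonneg _) (hb _)
  · exact Continuous.intervalIntegrable (by fun_prop) _ _
  · refine Filter.Eventually.of_forall fun t _ x _ => ?_
    have h := ((hf (x * t)).comp x ((hasDerivAt_id x).mul_const t)).const_mul (φ t)
    convert! h using 1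
    ring

lemma exists_abs_le_of_hasDerivAt {u w : ℝ → ℝ} {c : ℝ} (hc : 0 ≤ c)
    (hu : ∀ x, 0 < x → HasDerivAt u (w x) x)
    (hw : ∀ x, 0 < x → HasDerivAt w (-(1 - c / x ^ 2) * u x) x) :
    ∃ C, ∀ x, 1 ≤ x → |u x| ≤ C := by
  set H : ℝ → ℝ := fun x => (u x ^ 2 + w x ^ 2) * Real.exp (c / x) with hH
  have hd : ∀ x, 0 < x → HasDerivAt H
      (-(c / x ^ 2) * (u x - w x) ^ 2 * Real.exp (c / x)) x := by
    intro x hx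
    have h1 := ((hu x hx).pow 2).add ((hw x hx).pow 2)
    have h2 := (((hasDerivAt_inv hx.ne').const_mul c).exp)
    have h3 := h1.mul h2
    simp only [← div_eq_mul_inv] at h3
    convert! h3 using 1
    simp only [Pi.add_apply, Pi.pow_apply]
    field_simp
    ring
  have hanti : AntitoneOn H (Set.Ici 1) := by
    apply antitoneOn_of_deriv_nonpos (convex_Ici 1)
    · exact fun x hx => (hd x (lt_of_lt_of_le one_pos hx)).continuousAt.continuousWithinAt
    · intro x hx
      rw [interior_Ici] at hx
      exact (hd x (one_pos.trans hx)).differentiableAt.differentiableWithinAt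
    · intro x hx
      rw [interior_Ici] at hx
      rw [(hd x (one_pos.trans hx)).deriv, neg_mul, neg_mul]
      exact neg_nonpos.2 (by positivity)
  refine ⟨√(H 1), fun x hx => Real.abs_le_sqrt ?_⟩
  have h1 : H x ≤ H 1 := hanti (Set.mem_Ici.2 le_rfl) hx hx
  have h2 : 1 ≤ Real.exp (c / x) := Real.one_le_exp (by positivity)
  have h3 : u x ^ 2 + w x ^ 2 ≤ H x := le_mul_of_one_le_right (by positivity) h2
  nlinarith [sq_nonneg (w x)]

lemma bessel_integral_identity {γ : ℝ} (hγ : 0 < γ) (ω : ℝ) :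
    ω * (∫ t in (-1:ℝ)..1, (1 - t ^ 2) ^ γ * Real.cos (ω * t)) -
      ω * (∫ t in (-1:ℝ)..1, (1 - t ^ 2) ^ γ * t * t * Real.cos (ω * t)) =
    (2 * γ + 2) * ∫ t in (-1:ℝ)..1, (1 - t ^ 2) ^ γ * t * Real.sin (ω * t) := by
  have hφ : Continuous fun t : ℝ => (1 - t ^ 2) ^ γ :=
    Continuous.rpow_const (by fun_prop) fun _ => Or.inr hγ.le
  have hd : ∀ t ∈ Set.uIcc (-1:ℝ) 1, HasDerivAt
      (fun t : ℝ => (1 - t ^ 2) ^ (γ + 1) * Real.sin (ω * t))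
      (ω * ((1 - t ^ 2) ^ γ * Real.cos (ω * t)) -
        ω * ((1 - t ^ 2) ^ γ * t * t * Real.cos (ω * t)) -
        (2 * γ + 2) * ((1 - t ^ 2) ^ γ * t * Real.sin (ω * t))) t := by
    intro t ht
    rw [Set.uIcc_of_le (by norm_num)] at ht
    have h0 : 0 ≤ 1 - t ^ 2 := by nlinarith [ht.1, ht.2]
    have h1 : HasDerivAt (fun t : ℝ => 1 - t ^ 2) (-(2 * t)) t := by
      simpa using ((hasDerivAt_id t).pow 2).const_sub 1
    have h2 := h1.rpow_const (p := γ + 1) (Or.inr (by linarith))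
    have h3 : HasDerivAt (fun t : ℝ => Real.sin (ω * t)) (Real.cos (ω * t) * ω) t := by
      simpa using ((hasDerivAt_id t).const_mul ω).sin
    convert! h2.mul h3 using 1
    rw [Real.rpow_add_one' h0 (by linarith), add_sub_cancel_right]
    ring
  have hF := intervalIntegral.integral_eq_sub_of_hasDerivAt hd
    (Continuous.intervalIntegrable (by fun_prop) _ _)
  rw [intervalIntegral.integral_sub (Continuous.intervalIntegrable (by fun_prop) _ _)
      (Continuous.intervalIntegrable (by fun_prop) _ _),
    intervalIntegral.integral_sub (Continuous.intervalIntegrable (by fun_prop) _ _)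
      (Continuous.intervalIntegrable (by fun_prop) _ _)] at hF
  simp only [intervalIntegral.integral_const_mul] at hF
  norm_num [Real.zero_rpow (by linarith : γ + 1 ≠ 0)] at hF
  linarith

lemma exists_abs_bessel_integral_le {γ : ℝ} (hγ : 0 < γ) :
    ∃ C, ∀ ω : ℝ, 0 ≤ ω →
      |∫ t in (-1:ℝ)..1, (1 - t ^ 2) ^ γ * Real.cos (ω * t)| ≤ C * (1 + ω) ^ (-(γ + 1)) := by
  have hφ : Continuous fun t : ℝ => (1 - t ^ 2) ^ γ :=
    Continuous.rpow_const (by fun_prop) fun _ => Or.inr hγ.le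
  set k : ℝ → ℝ := fun ω => ∫ t in (-1:ℝ)..1, (1 - t ^ 2) ^ γ * Real.cos (ω * t) with hk
  set s : ℝ → ℝ := fun ω => ∫ t in (-1:ℝ)..1, (1 - t ^ 2) ^ γ * t * Real.sin (ω * t) with hs
  have hdk : ∀ ω, HasDerivAt k (-s ω) ω := by
    intro ω
    have h := hasDerivAt_integral_mul_comp_mul hφ Real.hasDerivAt_cos (by fun_prop)
      (fun x => by rw [abs_neg]; exact Real.abs_sin_le_one x) ω
    simpa [hs] using h
  have hds : ∀ ω, HasDerivAt s
      (∫ t in (-1:ℝ)..1, (1 - t ^ 2) ^ γ * t * t * Real.cos (ω * t)) ω := fun ω =>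
    hasDerivAt_integral_mul_comp_mul (hφ.mul continuous_id) Real.hasDerivAt_sin (by fun_prop)
      Real.abs_cos_le_one ω
  have hds' : ∀ ω, 0 < ω → HasDerivAt s (k ω - (2 * γ + 2) / ω * s ω) ω := by
    intro ω hω
    convert hds ω using 1
    have h := bessel_integral_identity hγ ω
    simp only [hk, hs]
    rw [div_mul_eq_mul_div, ← h, ← mul_sub, mul_div_cancel_left₀ _ hω.ne', sub_sub_cancel]
  obtain ⟨C, hC⟩ := exists_abs_le_of_hasDerivAt
    (u := fun ω => ω ^ (γ + 1) * k ω)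
    (w := fun ω => ω ^ (γ + 1) * (-s ω + (γ + 1) / ω * k ω))
    (c := (γ + 1) * γ) (by positivity)
    (by
      intro x hx
      have h := ((Real.hasDerivAt_rpow_const (p := γ + 1) (Or.inl hx.ne')).mul (hdk x))
      convert! h using 1
      rw [Real.rpow_sub_one hx.ne']
      field_simp
      ring)
    (by
      intro x hx
      have h := (Real.hasDerivAt_rpow_const (p := γ + 1) (Or.inl hx.ne')).mul
        ((hds' x hx).neg.add ((((hasDerivAt_inv hx.ne').const_mul (γ + 1))).mul (hdk x)))
      simp only [← div_eq_mul_inv] at h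
      convert! h using 1
      simp only [Pi.add_apply, Pi.neg_apply, Pi.mul_apply]
      rw [Real.rpow_sub_one hx.ne']
      field_simp
      ring)
  have hkc : Continuous k := continuous_iff_continuousAt.2 fun x => (hdk x).continuousAt
  obtain ⟨M, hM⟩ := (isCompact_Icc (a := (0:ℝ)) (b := 1)).exists_bound_of_continuousOn
    hkc.continuousOn
  have hC0 : 0 ≤ C := (abs_nonneg _).trans (hC 1 le_rfl)
  have hM0 : 0 ≤ M := (norm_nonneg _).trans (hM 0 (by simp))
  refine ⟨(C + M) * 2 ^ (γ + 1), fun ω hω => ?_⟩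
  have hpos : 0 < (1 + ω) ^ (γ + 1) := by positivity
  rw [Real.rpow_neg (by linarith), ← div_eq_mul_inv, le_div_iff₀ hpos]
  rcases le_total ω 1 with h | h
  · have h1 : |k ω| ≤ C + M := (hM ω ⟨hω, h⟩).trans (by linarith)
    have h2 : (1 + ω) ^ (γ + 1) ≤ 2 ^ (γ + 1) :=
      Real.rpow_le_rpow (by linarith) (by linarith) (by linarith)
    exact mul_le_mul h1 h2 hpos.le (by linarith)
  · have h1 := hC ω h
    have h2 : (1 + ω) ^ (γ + 1) ≤ 2 ^ (γ + 1) * ω ^ (γ + 1) := by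
      rw [← Real.mul_rpow (by norm_num) hω]
      exact Real.rpow_le_rpow (by linarith) (by linarith) (by linarith)
    rw [abs_mul, abs_of_nonneg (by positivity)] at h1
    calc |k ω| * (1 + ω) ^ (γ + 1) ≤ |k ω| * (2 ^ (γ + 1) * ω ^ (γ + 1)) := by gcongr
      _ = (ω ^ (γ + 1) * |k ω|) * 2 ^ (γ + 1) := by ring
      _ ≤ (C + M) * 2 ^ (γ + 1) := by gcongr; linarith

lemma integral_comp_rotation (g : ℝ × ℝ → ℂ) (θ : ℝ) :
    ∫ ξ : ℝ × ℝ, g (Real.cos θ * ξ.1 - Real.sin θ * ξ.2, Real.sin θ * ξ.1 + Real.cos θ * ξ.2) =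
      ∫ ξ : ℝ × ℝ, g ξ := by
  have hm := Complex.volume_preserving_equiv_real_prod
  have hrot := ((rotation (Circle.exp θ)).measurePreserving).integral_comp
    (rotation (Circle.exp θ)).toHomeomorph.measurableEmbedding (fun z : ℂ => g (z.re, z.im))
  rw [← hm.integral_comp', ← hm.integral_comp' g]
  refine Eq.trans ?_ hrot
  congr 1
  funext z
  simp [rotation_apply, Complex.exp_ofReal_mul_I_re, Complex.exp_ofReal_mul_I_im, add_comm]

lemma pnorm_two_rpow_two (ξ : ℝ × ℝ) : pnorm 2 ξ ^ (2:ℝ) = ξ.1 ^ 2 + ξ.2 ^ 2 := by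
  have h : 0 ≤ |ξ.1| ^ (2:ℝ) + |ξ.2| ^ (2:ℝ) := by positivity
  rw [pnorm, ← Real.rpow_mul h]
  norm_num

lemma Dcal_two_one_eq {β : ℝ} (hβ : 0 < β) (x : ℝ × ℝ) :
    Dcal 2 β 1 x = ((1 / Real.Gamma (β + 1) : ℝ) : ℂ) *
      ∫ ξ : ℝ × ℝ, ((max (1 - ξ.1 ^ 2 - ξ.2 ^ 2) 0 ^ β : ℝ) : ℂ) *
        e2πi (x.1 * ξ.1 + x.2 * ξ.2) := by
  simp only [Dcal, pnorm_two_rpow_two]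
  congr 1
  have hs : MeasurableSet {ξ : ℝ × ℝ | ξ.1 ^ 2 + ξ.2 ^ 2 < 1} :=
    measurableSet_lt (by fun_prop) (by fun_prop)
  rw [← integral_indicator hs]
  congr 1
  funext ξ
  by_cases h : ξ.1 ^ 2 + ξ.2 ^ 2 < 1
  · rw [Set.indicator_of_mem (by exact h), max_eq_left (by linarith), sub_sub]
  · rw [Set.indicator_of_notMem (by exact h), max_eq_right (by linarith),
      Real.zero_rpow hβ.ne']
    simp

lemma exists_integral_eq_radial (β : ℝ) (x : ℝ × ℝ) :
    ∃ r, ‖x‖ ≤ r ∧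
      (∫ ξ : ℝ × ℝ, ((max (1 - ξ.1 ^ 2 - ξ.2 ^ 2) 0 ^ β : ℝ) : ℂ) *
        e2πi (x.1 * ξ.1 + x.2 * ξ.2)) =
      ∫ ξ : ℝ × ℝ, ((max (1 - ξ.1 ^ 2 - ξ.2 ^ 2) 0 ^ β : ℝ) : ℂ) * e2πi (r * ξ.1) := by
  set z : ℂ := ⟨x.1, x.2⟩ with hz
  refine ⟨‖z‖, max_le (Complex.abs_re_le_norm z) (Complex.abs_im_le_norm z), ?_⟩
  rw [← integral_comp_rotation _ (Complex.arg z)]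
  have h1 : x.1 = ‖z‖ * Real.cos (Complex.arg z) := (Complex.norm_mul_cos_arg z).symm
  have h2 : x.2 = ‖z‖ * Real.sin (Complex.arg z) := (Complex.norm_mul_sin_arg z).symm
  have h3 := Real.sin_sq_add_cos_sq (Complex.arg z)
  congr 1
  funext ξ
  rw [h1, h2]
  generalize Real.cos (Complex.arg z) = c at *
  generalize Real.sin (Complex.arg z) = s at *
  have e1 : 1 - (c * ξ.1 - s * ξ.2) ^ 2 - (s * ξ.1 + c * ξ.2) ^ 2 = 1 - ξ.1 ^ 2 - ξ.2 ^ 2 := by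
    linear_combination (-ξ.1 ^ 2 - ξ.2 ^ 2) * h3
  have e2 : ‖z‖ * c * (c * ξ.1 - s * ξ.2) + ‖z‖ * s * (s * ξ.1 + c * ξ.2) = ‖z‖ * ξ.1 := by
    linear_combination ‖z‖ * ξ.1 * h3
  simp only [e1, e2]

lemma continuous_max_zero_rpow {X : Type*} [TopologicalSpace X] {f : X → ℝ} (hf : Continuous f)
    {β : ℝ} (hβ : 0 < β) : Continuous fun x => max (f x) 0 ^ β :=
  (hf.max continuous_const).rpow_const fun _ => Or.inr hβ.le

lemma continuous_e2πi : Continuous e2πi := by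
  unfold e2πi
  fun_prop

lemma integral_max_sub_sq_rpow {β : ℝ} (hβ : 0 < β) (A : ℝ) :
    ∫ b : ℝ, max (A - b ^ 2) 0 ^ β =
      max A 0 ^ (β + 1 / 2) * ∫ b : ℝ, max (1 - b ^ 2) 0 ^ β := by
  rcases le_or_gt A 0 with h | h
  · rw [max_eq_right h, Real.zero_rpow (by linarith), zero_mul]
    refine integral_eq_zero_of_ae (Filter.Eventually.of_forall fun b => ?_)
    simp only [Pi.zero_apply]
    rw [max_eq_right (by nlinarith [sq_nonneg b]), Real.zero_rpow hβ.ne']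
  · have hs : 0 < √A := Real.sqrt_pos.2 h
    have key := Measure.integral_comp_mul_left (fun b : ℝ => max (A - b ^ 2) 0 ^ β) (√A)
    have hc : ∀ b : ℝ, max (A - (√A * b) ^ 2) 0 ^ β = A ^ β * max (1 - b ^ 2) 0 ^ β := by
      intro b
      rw [← Real.mul_rpow h.le (le_max_right _ _), mul_max_of_nonneg _ _ h.le, mul_pow,
        Real.sq_sqrt h.le, mul_zero, mul_sub, mul_one]
    simp only [hc] at key
    rw [integral_const_mul, abs_of_pos (inv_pos.2 hs), smul_eq_mul, eq_inv_mul_iff_mul_eq₀ hs.ne']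
      at key
    rw [max_eq_left h.le, Real.rpow_add h, ← Real.sqrt_eq_rpow, ← key]
    ring

lemma integrable_bump_mul_e2πi {β : ℝ} (hβ : 0 < β) (r : ℝ) :
    Integrable (fun ξ : ℝ × ℝ =>
      ((max (1 - ξ.1 ^ 2 - ξ.2 ^ 2) 0 ^ β : ℝ) : ℂ) * e2πi (r * ξ.1)) := by
  apply Continuous.integrable_of_hasCompactSupport
  · exact (Complex.continuous_ofReal.comp
      (continuous_max_zero_rpow (by fun_prop) hβ)).mul (continuous_e2πi.comp (by fun_prop))
  · refine HasCompactSupport.of_support_subset_isCompact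
      ((isCompact_Icc (a := (-1:ℝ)) (b := 1)).prod (isCompact_Icc (a := (-1:ℝ)) (b := 1)))
      fun ξ hξ => ?_
    have h : 0 < 1 - ξ.1 ^ 2 - ξ.2 ^ 2 := by
      by_contra! h
      apply hξ
      simp only
      rw [max_eq_right h, Real.zero_rpow hβ.ne']
      simp
    have h1 := abs_le.1 (abs_le_one_iff_mul_self_le_one.2
      (by nlinarith [sq_nonneg ξ.2] : ξ.1 * ξ.1 ≤ 1))
    have h2 := abs_le.1 (abs_le_one_iff_mul_self_le_one.2
      (by nlinarith [sq_nonneg ξ.1] : ξ.2 * ξ.2 ≤ 1))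
    exact ⟨⟨h1.1, h1.2⟩, ⟨h2.1, h2.2⟩⟩

lemma integral_max_mul_e2πi {γ : ℝ} (hγ : 0 < γ) (r : ℝ) :
    ∫ a : ℝ, ((max (1 - a ^ 2) 0 ^ γ : ℝ) : ℂ) * e2πi (r * a) =
      ((∫ a in (-1:ℝ)..1, (1 - a ^ 2) ^ γ * Real.cos (2 * π * r * a) : ℝ) : ℂ) := by
  have hφ : Continuous fun t : ℝ => (1 - t ^ 2) ^ γ :=
    Continuous.rpow_const (by fun_prop) fun _ => Or.inr hγ.le
  have hsin : ∫ a in (-1:ℝ)..1, (1 - a ^ 2) ^ γ * Real.sin (2 * π * r * a) = 0 := by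
    have h := intervalIntegral.integral_comp_neg (a := -1) (b := 1)
      (fun a : ℝ => (1 - a ^ 2) ^ γ * Real.sin (2 * π * r * a))
    simp only [neg_sq, mul_neg, Real.sin_neg, intervalIntegral.integral_neg, neg_neg] at h
    linarith
  have hsupp : ∀ a : ℝ, a ∉ Set.Ioc (-1:ℝ) 1 →
      ((max (1 - a ^ 2) 0 ^ γ : ℝ) : ℂ) * e2πi (r * a) = 0 := by
    intro a ha
    have h : 1 - a ^ 2 ≤ 0 := by
      by_contra! h
      have h1 := abs_lt.1 ((sq_lt_one_iff_abs_lt_one a).1 (by linarith))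
      exact ha ⟨h1.1, h1.2.le⟩
    rw [max_eq_right h, Real.zero_rpow hγ.ne']
    simp
  rw [← setIntegral_eq_integral_of_forall_compl_eq_zero hsupp,
    ← intervalIntegral.integral_of_le (by norm_num)]
  have hcongr : ∀ a ∈ Set.uIcc (-1:ℝ) 1,
      ((max (1 - a ^ 2) 0 ^ γ : ℝ) : ℂ) * e2πi (r * a) =
        (((1 - a ^ 2) ^ γ * Real.cos (2 * π * r * a) : ℝ) : ℂ) +
          (((1 - a ^ 2) ^ γ * Real.sin (2 * π * r * a) : ℝ) : ℂ) * Complex.I := by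
    intro a ha
    rw [Set.uIcc_of_le (by norm_num)] at ha
    rw [max_eq_left (by nlinarith [ha.1, ha.2]), e2πi, Complex.exp_mul_I, ← Complex.ofReal_cos,
      ← Complex.ofReal_sin, ← mul_assoc (2 * π)]
    push_cast
    ring
  rw [intervalIntegral.integral_congr hcongr, intervalIntegral.integral_add
    (Continuous.intervalIntegrable (by fun_prop) _ _)
    (Continuous.intervalIntegrable (by fun_prop) _ _), intervalIntegral.integral_mul_const,
    intervalIntegral.integral_ofReal, intervalIntegral.integral_ofReal, hsin]
  simp

lemma integral_bump_mul_e2πi {β : ℝ} (hβ : 0 < β) (r : ℝ) :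
    ∫ ξ : ℝ × ℝ, ((max (1 - ξ.1 ^ 2 - ξ.2 ^ 2) 0 ^ β : ℝ) : ℂ) * e2πi (r * ξ.1) =
      (((∫ b : ℝ, max (1 - b ^ 2) 0 ^ β) * ∫ a in (-1:ℝ)..1,
        (1 - a ^ 2) ^ (β + 1 / 2) * Real.cos (2 * π * r * a) : ℝ) : ℂ) := by
  rw [Measure.volume_eq_prod, integral_prod _ (integrable_bump_mul_e2πi hβ r)]
  rw [Complex.ofReal_mul, ← integral_max_mul_e2πi (by linarith), ← integral_const_mul]
  congr 1
  funext a
  dsimp only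
  rw [integral_mul_const, integral_complex_ofReal, integral_max_sub_sq_rpow hβ, Complex.ofReal_mul]
  ring

lemma stronglyMeasurable_Dcal_two {β : ℝ} (hβ : 0 < β) :
    StronglyMeasurable fun x : ℝ × ℝ => Dcal 2 β 1 x := by
  simp only [Dcal_two_one_eq hβ]
  refine stronglyMeasurable_const.mul (StronglyMeasurable.integral_prod_right'
    (f := fun p : (ℝ × ℝ) × (ℝ × ℝ) => ((max (1 - p.2.1 ^ 2 - p.2.2 ^ 2) 0 ^ β : ℝ) : ℂ) *
        e2πi (p.1.1 * p.2.1 + p.1.2 * p.2.2)) (Continuous.stronglyMeasurable ?_))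
  exact (Complex.continuous_ofReal.comp
    (continuous_max_zero_rpow (by fun_prop) hβ)).mul (continuous_e2πi.comp (by fun_prop))

/-- For `p = 2`, the integrability assumption of the main theorem holds whenever `β > 1/2`. -/
theorem Dcal_two_integrable (β : ℝ) (hβ : 1 / 2 < β) :
    Integrable (fun x : ℝ × ℝ => Dcal 2 β 1 x) := by
  have hβ0 : 0 < β := by linarith
  obtain ⟨C, hC⟩ := exists_abs_bessel_integral_le (γ := β + 1 / 2) (by linarith)
  have hC0 : 0 ≤ C := by simpa using (abs_nonneg _).trans (hC 0 le_rfl)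
  have hint : Integrable fun x : ℝ × ℝ => (1 + ‖x‖) ^ (-(β + 1 / 2 + 1)) :=
    integrable_one_add_norm (by simp; linarith)
  set D : ℝ := |1 / Real.Gamma (β + 1)| * |∫ b : ℝ, max (1 - b ^ 2) 0 ^ β|
  refine (hint.const_mul (D * C)).mono' (stronglyMeasurable_Dcal_two hβ0).aestronglyMeasurable
    (Filter.Eventually.of_forall fun x => ?_)
  obtain ⟨r, hr, he⟩ := exists_integral_eq_radial β x
  have hr0 : 0 ≤ r := (norm_nonneg x).trans hr
  rw [Dcal_two_one_eq hβ0, he, integral_bump_mul_e2πi hβ0, norm_mul, Complex.norm_real,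
    Complex.norm_real, Real.norm_eq_abs, Real.norm_eq_abs, abs_mul, ← mul_assoc, mul_assoc D]
  refine mul_le_mul_of_nonneg_left ((hC (2 * π * r) (by positivity)).trans ?_) (by positivity)
  refine mul_le_mul_of_nonneg_left (Real.rpow_le_rpow_of_nonpos (by positivity) ?_
    (by linarith)) hC0
  nlinarith [Real.pi_gt_three]
end
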